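/- (Theorem 2, case (h2).) Let {e_n} be a sequence in H and {α_n} ⊆ (0,1], {β_n} ⊆ [0,1] real sequences such that: (i) α_n → 0 and ∑ α_n = +∞; (ii) limsup β_n < 1, and either (β_{n+1} − β_n)/α_n → 0 or ∑ |β_{n+1} − β_n| < +∞, and either (α_{n+1} − α_n)/α_n → 0 or ∑ |α_{n+1} − α_n| < +∞; (iii) ∑ ‖e_n‖ < +∞ or ‖e_n‖/α_n → 0. Then for every x_0 ∈ Q, the sequence {x_n} generated by x_{n+1} = β_n x_n + (1 − β_n) P_Q(α_n f(x_n) + (T x_n − α_n F(T x_n)) + e_n) converges strongly to q*, the unique point of C = Fix(T) satisfying ⟨F(q*) − f(q*), x − q*⟩ ≥ 0 for all x ∈ C. -/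

import Mathlib

open scoped RealInnerProductSpace
open Filter

/-- A real sequence that splits as `o(α)` plus a summable sequence. -/
def NegligibleRate (α b : ℕ → ℝ) : Prop :=
  ∃ r s : ℕ → ℝ, (∀ n, b n = r n + s n) ∧ Tendsto (fun n => r n / α n) atTop (nhds 0) ∧ Summable s

namespace NegligibleRate

variable {α b c : ℕ → ℝ}

lemma of_summable_or (h : Summable b ∨ Tendsto (fun n => b n / α n) atTop (nhds 0)) :
    NegligibleRate α b := by
  rcases h with h | h
  · exact ⟨0, b, by simp, by simp, h⟩
  · exact ⟨b, 0, by simp, h, summable_zero⟩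

lemma add (hb : NegligibleRate α b) (hc : NegligibleRate α c) :
    NegligibleRate α (fun n => b n + c n) := by
  obtain ⟨r, s, h, hr, hs⟩ := hb
  obtain ⟨r', s', h', hr', hs'⟩ := hc
  refine ⟨r + r', s + s', fun n => ?_, ?_, hs.add hs'⟩
  · simp only [h, h', Pi.add_apply]; ring
  · simpa [add_div] using hr.add hr'

lemma const_mul (K : ℝ) (hb : NegligibleRate α b) : NegligibleRate α (fun n => K * b n) := by
  obtain ⟨r, s, h, hr, hs⟩ := hb
  refine ⟨fun n => K * r n, fun n => K * s n, fun n => by simp only [h]; ring, ?_,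
    hs.mul_left K⟩
  simpa [mul_div_assoc] using hr.const_mul K

lemma comp_add (N : ℕ) (hb : NegligibleRate α b) :
    NegligibleRate (fun n => α (n + N)) (fun n => b (n + N)) := by
  obtain ⟨r, s, h, hr, hs⟩ := hb
  exact ⟨fun n => r (n + N), fun n => s (n + N), fun n => h _,
    (tendsto_add_atTop_iff_nat (f := fun n => r n / α n) N).2 hr, (summable_nat_add_iff N).2 hs⟩

end NegligibleRate

/-- A sequence with `u (n + 1) ≤ (1 - γ n) u n`, `0 ≤ γ ≤ 1`, `∑ γ = ∞` is eventually below any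
positive number. -/
lemma eventually_lt_of_le_one_sub_mul {u γ : ℕ → ℝ} {N : ℕ} (hγ0 : ∀ n, 0 ≤ γ n)
    (hγ1 : ∀ n, γ n ≤ 1) (hγ : ¬ Summable γ) (hu : ∀ n ≥ N, u (n + 1) ≤ (1 - γ n) * u n)
    {ε : ℝ} (hε : 0 < ε) : ∀ᶠ n in atTop, u n < ε := by
  have key : ∀ n, u (n + N) ≤ Real.exp (-∑ i ∈ Finset.range n, γ (i + N)) * max (u N) 0 := by
    intro n
    induction n with
    | zero => simp
    | succ n ih =>
      have hE : 1 - γ (n + N) ≤ Real.exp (-γ (n + N)) := Real.one_sub_le_exp_neg _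
      have hm : 0 ≤ max (u N) 0 := le_max_right _ _
      have h1 : 0 ≤ 1 - γ (n + N) := sub_nonneg.2 (hγ1 _)
      rw [Finset.sum_range_succ, neg_add, Real.exp_add, add_right_comm]
      calc u (n + N + 1) ≤ (1 - γ (n + N)) * u (n + N) := hu _ (by omega)
        _ ≤ (1 - γ (n + N)) * (Real.exp (-∑ i ∈ Finset.range n, γ (i + N)) * max (u N) 0) := by
          gcongr
        _ ≤ Real.exp (-γ (n + N)) *
            (Real.exp (-∑ i ∈ Finset.range n, γ (i + N)) * max (u N) 0) := by
          gcongr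
        _ = _ := by ring
  have hsum : Tendsto (fun n => ∑ i ∈ Finset.range n, γ (i + N)) atTop atTop :=
    (not_summable_iff_tendsto_nat_atTop_of_nonneg fun n => hγ0 _).1
      fun h => hγ ((summable_nat_add_iff N).1 h)
  have hlim := ((Real.tendsto_exp_atBot.comp
    (tendsto_neg_atTop_atBot.comp hsum)).mul_const (max (u N) 0))
  rw [zero_mul] at hlim
  have hev := hlim.eventually (gt_mem_nhds hε)
  have : ∀ᶠ n in atTop, u (n + N) < ε := hev.mono fun n hn => (key n).trans_lt hn
  rw [← map_add_atTop_eq_nat N]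
  exact this

/-- Xu's lemma: if `a (n + 1) ≤ (1 - c α n) a n + b n` with `∑ α = ∞` and `b` negligible with
respect to `α`, then the nonnegative sequence `a` tends to `0`. -/
lemma tendsto_zero_of_le_one_sub_mul_add {a α b : ℕ → ℝ} {c : ℝ} (hc : 0 < c)
    (hα0 : ∀ n, 0 < α n) (hα1 : ∀ n, c * α n ≤ 1) (hα : ¬ Summable α) (hb : NegligibleRate α b)
    (ha0 : ∀ n, 0 ≤ a n) (ha : ∀ n, a (n + 1) ≤ (1 - c * α n) * a n + b n) :
    Tendsto a atTop (nhds 0) := by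
  obtain ⟨r, s, hrs, hr, hs⟩ := hb
  set R : ℕ → ℝ := fun n => ∑' k, s (k + n) with hR
  have hR0 : Tendsto R atTop (nhds 0) := tendsto_sum_nat_add s
  have hRs : ∀ n, R n = s n + R (n + 1) := by
    intro n
    have := ((summable_nat_add_iff n).2 hs).tsum_eq_zero_add
    simpa [hR, add_assoc, add_comm 1] using this
  have hδ : Tendsto (fun n => r n / α n / c + R n) atTop (nhds 0) := by
    simpa using (hr.div_const c).add hR0
  refine tendsto_order.2 ⟨fun ε hε => Eventually.of_forall fun n => hε.trans_le (ha0 n),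
    fun ε hε => ?_⟩
  obtain ⟨N, hN⟩ := eventually_atTop.1 (hδ.eventually (gt_mem_nhds (by positivity : 0 < ε / 3)))
  have hu := eventually_lt_of_le_one_sub_mul (u := fun n => a n + R n - ε / 3)
    (γ := fun n => c * α n) (N := N) (fun n => by have := hα0 n; positivity) hα1
    (by rwa [summable_mul_left_iff hc.ne']) (fun n hn => by
      have h1 := hN n hn
      have h2 := ha n
      have h3 := hRs n
      have h4 : r n = c * α n * (r n / α n / c) := by
        have := (hα0 n).ne'
        field_simp
      rw [hrs] at h2
      have h5 : c * α n * (r n / α n / c + R n) ≤ c * α n * (ε / 3) :=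
        mul_le_mul_of_nonneg_left h1.le (by have := hα0 n; positivity)
      rw [mul_add, ← h4] at h5
      nlinarith) (by positivity : 0 < ε / 3)
  filter_upwards [hu, hR0.eventually (lt_mem_nhds (by linarith : -(ε / 3) < 0))] with n h1 h2
  linarith

lemma norm_metricProjection_sub_le {H : Type*} [NormedAddCommGroup H] [InnerProductSpace ℝ H]
    {Q : Set H} {P : H → H} (hP : ∀ x : H, P x ∈ Q ∧ ∀ y ∈ Q, ⟪x - P x, y - P x⟫ ≤ 0) (u v : H) :
    ‖P u - P v‖ ≤ ‖u - v‖ := by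
  have h1 := (hP u).2 _ (hP v).1
  have h2 := (hP v).2 _ (hP u).1
  have h3 : ‖P u - P v‖ ^ 2 ≤ ⟪u - v, P u - P v⟫ := by
    rw [← real_inner_self_eq_norm_sq]
    simp only [inner_sub_left, inner_sub_right] at *
    linarith
  have h4 := real_inner_le_norm (u - v) (P u - P v)
  by_contra! h
  nlinarith [norm_nonneg (P u - P v), norm_nonneg (u - v)]

section WeakLimits

variable {H : Type*} [NormedAddCommGroup H] [InnerProductSpace ℝ H]

/-- Bounded sequences in a Hilbert space converge weakly along any ultrafilter. -/
lemma exists_weak_limit_of_bounded [CompleteSpace H] (U : Ultrafilter ℕ) {x : ℕ → H} {R : ℝ}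
    (hx : ∀ n, ‖x n‖ ≤ R) : ∃ p : H, ∀ y, Tendsto (fun n => ⟪x n, y⟫) U (nhds ⟪p, y⟫) := by
  let φ : ℕ → WeakDual ℝ H := fun n =>
    StrongDual.toWeakDual (InnerProductSpace.toDual ℝ H (x n))
  have hcomp := WeakDual.isCompact_closedBall (𝕜 := ℝ) (E := H) 0 R
  obtain ⟨ψ, -, hψ⟩ := hcomp.ultrafilter_le_nhds (U.map φ) 
    (le_principal_iff.2 <| Ultrafilter.mem_map.2 <| univ_mem' fun n => by simpa [φ] using hx n)
  refine ⟨(InnerProductSpace.toDual ℝ H).symm (WeakDual.toStrongDual ψ), fun y => ?_⟩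
  rw [InnerProductSpace.toDual_symm_apply]
  exact ((WeakDual.eval_continuous y).tendsto ψ).comp hψ

/-- Demiclosedness principle, along a filter. -/
lemma isFixedPt_of_weak_limit {Q : Set H} {P T : H → H}
    (hP : ∀ x : H, P x ∈ Q ∧ ∀ y ∈ Q, ⟪x - P x, y - P x⟫ ≤ 0)
    (hT : ∀ x ∈ Q, ∀ y ∈ Q, ‖T x - T y‖ ≤ ‖x - y‖) {l : Filter ℕ} [l.NeBot] {x : ℕ → H} {R : ℝ}
    (hxQ : ∀ n, x n ∈ Q) (hx : ∀ n, ‖x n‖ ≤ R)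
    (hxT : Tendsto (fun n => ‖x n - T (x n)‖) l (nhds 0)) {p : H}
    (hp : ∀ y, Tendsto (fun n => ⟪x n, y⟫) l (nhds ⟪p, y⟫)) : p ∈ Q ∧ T p = p := by
  have hpQ : p ∈ Q := by
    have h : Tendsto (fun n => ⟪x n, p - P p⟫ - ⟪P p, p - P p⟫) l
        (nhds (⟪p, p - P p⟫ - ⟪P p, p - P p⟫)) := (hp _).sub_const _
    have h0 : ⟪p, p - P p⟫ - ⟪P p, p - P p⟫ ≤ 0 :=
      le_of_tendsto h <| Eventually.of_forall fun n => by
        rw [← inner_sub_left, real_inner_comm]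
        exact (hP p).2 _ (hxQ n)
    rw [← inner_sub_left, real_inner_self_nonpos, sub_eq_zero] at h0
    rw [h0]
    exact (hP p).1
  refine ⟨hpQ, ?_⟩
  have hbound : ∀ n, ‖p - T p‖ ^ 2 ≤ ‖x n - T (x n)‖ ^ 2
      + 2 * ‖x n - T (x n)‖ * (R + ‖p‖) - 2 * (⟪x n, p - T p⟫ - ⟪p, p - T p⟫) := by
    intro n
    have h1 : ‖x n - T p‖ ≤ ‖x n - T (x n)‖ + ‖x n - p‖ :=
      (norm_sub_le_norm_sub_add_norm_sub _ (T (x n)) _).trans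
        (add_le_add_right (hT _ (hxQ n) _ hpQ) _)
    have h2 : ‖x n - p‖ ≤ R + ‖p‖ := (norm_sub_le _ _).trans (add_le_add_left (hx n) _)
    have h3 : ‖x n - T p‖ ^ 2 = ‖x n - p‖ ^ 2 + 2 * ⟪x n - p, p - T p⟫ + ‖p - T p‖ ^ 2 := by
      rw [← norm_add_sq_real, sub_add_sub_cancel]
    rw [← inner_sub_left]
    nlinarith [norm_nonneg (x n - T p), norm_nonneg (x n - T (x n)), norm_nonneg (x n - p),
      pow_le_pow_left₀ (norm_nonneg _) h1 2,
      mul_le_mul_of_nonneg_left h2 (norm_nonneg (x n - T (x n)))]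
  have hlim : Tendsto (fun n => ‖x n - T (x n)‖ ^ 2
      + 2 * ‖x n - T (x n)‖ * (R + ‖p‖) - 2 * (⟪x n, p - T p⟫ - ⟪p, p - T p⟫)) l (nhds 0) := by
    simpa using ((hxT.pow 2).add ((hxT.const_mul 2).mul_const (R + ‖p‖))).sub
      (((hp (p - T p)).sub_const ⟪p, p - T p⟫).const_mul 2)
  have h0 : ‖p - T p‖ ^ 2 ≤ 0 := ge_of_tendsto hlim (Eventually.of_forall hbound)
  have h1 : ‖p - T p‖ = 0 := by nlinarith [norm_nonneg (p - T p)]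
  exact (sub_eq_zero.1 (norm_eq_zero.1 h1)).symm

/-- Asymptotically fixed bounded sequences satisfy the limiting variational inequality. -/
lemma eventually_inner_lt_of_asymptotically_fixed [CompleteSpace H] {Q : Set H} {P T : H → H}
    (hP : ∀ x : H, P x ∈ Q ∧ ∀ y ∈ Q, ⟪x - P x, y - P x⟫ ≤ 0)
    (hT : ∀ x ∈ Q, ∀ y ∈ Q, ‖T x - T y‖ ≤ ‖x - y‖) {x : ℕ → H} {R : ℝ}
    (hxQ : ∀ n, x n ∈ Q) (hx : ∀ n, ‖x n‖ ≤ R)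
    (hxT : Tendsto (fun n => ‖x n - T (x n)‖) atTop (nhds 0)) {v q : H}
    (hv : ∀ p ∈ Q, T p = p → ⟪v, p - q⟫ ≤ 0) {ε : ℝ} (hε : 0 < ε) :
    ∀ᶠ n in atTop, ⟪v, x n - q⟫ < ε := by
  by_contra hcon
  have hne : (atTop ⊓ 𝓟 {n | ¬ ⟪v, x n - q⟫ < ε}).NeBot :=
    frequently_iff_neBot.1 (not_eventually.1 hcon)
  let U := Ultrafilter.of (atTop ⊓ 𝓟 {n | ¬ ⟪v, x n - q⟫ < ε})
  have hU : (U : Filter ℕ) ≤ atTop ⊓ 𝓟 {n | ¬ ⟪v, x n - q⟫ < ε} := Ultrafilter.of_le _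
  obtain ⟨p, hp⟩ := exists_weak_limit_of_bounded U hx
  obtain ⟨hpQ, hTp⟩ := isFixedPt_of_weak_limit hP hT hxQ hx
    (hxT.mono_left (hU.trans inf_le_left)) hp
  have hlim : Tendsto (fun n => ⟪v, x n - q⟫) U (nhds ⟪v, p - q⟫) := by
    simpa only [inner_sub_right, real_inner_comm v] using (hp v).sub_const ⟪q, v⟫
  have hge : ε ≤ ⟪v, p - q⟫ := ge_of_tendsto hlim <| by
    have h : {n | ¬ ⟪v, x n - q⟫ < ε} ∈ (U : Filter ℕ) :=
      le_principal_iff.1 (hU.trans inf_le_right)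
    filter_upwards [h] with n hn using not_lt.1 hn
  linarith [hv p hpQ hTp]

end WeakLimits

section Viscosity

variable {H : Type*} [NormedAddCommGroup H] [InnerProductSpace ℝ H]

lemma norm_regularized_step_sub_le {Q : Set H} {T f F : H → H} {L κ η a : ℝ}
    (hTmaps : ∀ x ∈ Q, T x ∈ Q) (hT : ∀ x ∈ Q, ∀ y ∈ Q, ‖T x - T y‖ ≤ ‖x - y‖)
    (hf : ∀ x ∈ Q, ∀ y ∈ Q, ‖f x - f y‖ ≤ L * ‖x - y‖)
    (hFLip : ∀ x ∈ Q, ∀ y ∈ Q, ‖F x - F y‖ ≤ κ * ‖x - y‖)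
    (hFmono : ∀ x ∈ Q, ∀ y ∈ Q, η * ‖x - y‖ ^ 2 ≤ ⟪F x - F y, x - y⟫)
    (ha : 0 ≤ a) (haκ : a * κ ^ 2 ≤ η - L) (haη : a * (η + L) ≤ 2)
    {x y : H} (hx : x ∈ Q) (hy : y ∈ Q) :
    ‖(T x + a • (f x - F (T x))) - (T y + a • (f y - F (T y)))‖
      ≤ (1 - (η - L) / 2 * a) * ‖x - y‖ := by
  have hw := hT x hx y hy
  have hv := hFLip _ (hTmaps x hx) _ (hTmaps y hy)
  have hm := hFmono _ (hTmaps x hx) _ (hTmaps y hy)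
  have hff := hf x hx y hy
  have hid : (T x + a • (f x - F (T x))) - (T y + a • (f y - F (T y)))
      = ((T x - T y) - a • (F (T x) - F (T y))) + a • (f x - f y) := by module
  have hτ : 0 ≤ 1 - a * ((η + L) / 2) := by linarith
  have hsq : ‖(T x - T y) - a • (F (T x) - F (T y))‖ ^ 2
      ≤ ((1 - a * ((η + L) / 2)) * ‖T x - T y‖) ^ 2 := by
    rw [norm_sub_sq_real, real_inner_smul_right, real_inner_comm, norm_smul, Real.norm_of_nonneg ha]
    have h1 : (a * ‖F (T x) - F (T y)‖) ^ 2 ≤ (a * (κ * ‖T x - T y‖)) ^ 2 := by gcongr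
    have h2 := mul_le_mul_of_nonneg_left hm ha
    have h3 := mul_le_mul_of_nonneg_left haκ (mul_nonneg ha (sq_nonneg ‖T x - T y‖))
    nlinarith [sq_nonneg (a * ((η + L) / 2) * ‖T x - T y‖)]
  have h1 : ‖(T x - T y) - a • (F (T x) - F (T y))‖ ≤ (1 - a * ((η + L) / 2)) * ‖x - y‖ :=
    (le_of_sq_le_sq hsq (by positivity)).trans (by gcongr)
  have h2 : ‖a • (f x - f y)‖ ≤ a * (L * ‖x - y‖) := by
    rw [norm_smul, Real.norm_of_nonneg ha]
    gcongr
  rw [hid]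
  refine (norm_add_le _ _).trans ((add_le_add h1 h2).trans_eq ?_)
  ring

/-- Convergence of the relaxed projected iteration without error terms, assuming that each
`T + α n • g` is a contraction of `Q` with constant `1 - ρ α n`. -/
lemma tendsto_relaxed_projected_iteration [CompleteSpace H] {Q : Set H} (hQ : Convex ℝ Q)
    {P T g : H → H} (hP : ∀ x : H, P x ∈ Q ∧ ∀ y ∈ Q, ⟪x - P x, y - P x⟫ ≤ 0)
    (hTmaps : ∀ x ∈ Q, T x ∈ Q) (hT : ∀ x ∈ Q, ∀ y ∈ Q, ‖T x - T y‖ ≤ ‖x - y‖)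
    {L ρ b : ℝ} (hL : 0 ≤ L) (hg : ∀ x ∈ Q, ∀ y ∈ Q, ‖g x - g y‖ ≤ L * ‖x - y‖)
    (hρ : 0 < ρ) (hb : b < 1) {α β : ℕ → ℝ} (hα : ∀ n, 0 < α n) (hαρ : ∀ n, ρ * α n ≤ 1)
    (hcontr : ∀ n, ∀ x ∈ Q, ∀ y ∈ Q,
      ‖(T x + α n • g x) - (T y + α n • g y)‖ ≤ (1 - ρ * α n) * ‖x - y‖)
    (hα0 : Tendsto α atTop (nhds 0)) (hαsum : ¬ Summable α)
    (hβ0 : ∀ n, 0 ≤ β n) (hβb : ∀ n, β n ≤ b)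
    (hαreg : NegligibleRate α fun n => |α (n + 1) - α n|)
    (hβreg : NegligibleRate α fun n => |β (n + 1) - β n|)
    {q : H} (hqQ : q ∈ Q) (hTq : T q = q) (hq : ∀ p ∈ Q, T p = p → ⟪g q, p - q⟫ ≤ 0)
    {x : ℕ → H} (hx0 : x 0 ∈ Q)
    (hx : ∀ n, x (n + 1) = β n • x n + (1 - β n) • P (T (x n) + α n • g (x n))) :
    Tendsto x atTop (nhds q) := by
  have hβ1 : ∀ n, 0 < 1 - β n := fun n => by linarith [hβb n]
  set y : ℕ → H := fun n => P (T (x n) + α n • g (x n))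
  have hyQ : ∀ n, y n ∈ Q := fun n => (hP _).1
  have hxQ : ∀ n, x n ∈ Q := by
    intro n
    induction n with
    | zero => exact hx0
    | succ n ih =>
      rw [hx]
      exact hQ ih (hyQ n) (hβ0 n) (hβ1 n).le (by ring)
  have hPQ : ∀ u ∈ Q, P u = u := by
    intro u hu
    have h := (hP u).2 u hu
    rw [real_inner_self_nonpos, sub_eq_zero] at h
    exact h.symm
  have hyq : ∀ n, ‖y n - q‖ ≤ (1 - ρ * α n) * ‖x n - q‖ + α n * ‖g q‖ := by
    intro n
    have h1 := norm_metricProjection_sub_le hP (T (x n) + α n • g (x n)) q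
    rw [hPQ q hqQ] at h1
    have h2 := hcontr n _ (hxQ n) q hqQ
    have h3 : T (x n) + α n • g (x n) - q
        = (T (x n) + α n • g (x n) - (T q + α n • g q)) + α n • g q := by rw [hTq]; abel
    rw [h3] at h1
    have h4 := norm_add_le (T (x n) + α n • g (x n) - (T q + α n • g q)) (α n • g q)
    rw [norm_smul, Real.norm_of_nonneg (hα n).le] at h4
    linarith
  obtain ⟨R, hR⟩ : ∃ R, ∀ n, ‖x n - q‖ ≤ R := by
    refine ⟨max ‖x 0 - q‖ (‖g q‖ / ρ), fun n => ?_⟩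
    induction n with
    | zero => exact le_max_left _ _
    | succ n ih =>
      set M := max ‖x 0 - q‖ (‖g q‖ / ρ)
      have h1 : ‖g q‖ ≤ ρ * M := by
        rw [mul_comm, ← div_le_iff₀ hρ]
        exact le_max_right _ _
      have h2 : ‖y n - q‖ ≤ M := by
        have h3 := mul_le_mul_of_nonneg_left ih (sub_nonneg.2 (hαρ n))
        have h4 := mul_le_mul_of_nonneg_left h1 (hα n).le
        nlinarith [hyq n]
      have h3 : x (n + 1) - q = β n • (x n - q) + (1 - β n) • (y n - q) := by
        rw [hx]; module
      rw [h3]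
      refine (norm_add_le _ _).trans ?_
      rw [norm_smul, norm_smul, Real.norm_of_nonneg (hβ0 n), Real.norm_of_nonneg (hβ1 n).le]
      nlinarith [mul_le_mul_of_nonneg_left ih (hβ0 n), mul_le_mul_of_nonneg_left h2 (hβ1 n).le]
  have hR0 : 0 ≤ R := (norm_nonneg _).trans (hR 0)
  have hyR : ∀ n, ‖y n - q‖ ≤ R + ‖g q‖ / ρ := by
    intro n
    have h1 : α n * ‖g q‖ ≤ ‖g q‖ / ρ := by
      rw [le_div_iff₀ hρ]
      nlinarith [mul_le_mul_of_nonneg_right (hαρ n) (norm_nonneg (g q))]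
    have h2 : (1 - ρ * α n) * ‖x n - q‖ ≤ 1 * R :=
      mul_le_mul (by nlinarith [hα n]) (hR n) (norm_nonneg _) zero_le_one
    linarith [hyq n]
  have hgR : ∀ n, ‖g (x n)‖ ≤ ‖g q‖ + L * R := by
    intro n
    have h1 := norm_add_le (g q) (g (x n) - g q)
    rw [add_sub_cancel] at h1
    linarith [hg _ (hxQ n) q hqQ, mul_le_mul_of_nonneg_left (hR n) hL]
  have hc : 0 < (1 - b) * ρ := mul_pos (by linarith) hρ
  have hb0 : 0 ≤ b := (hβ0 0).trans (hβb 0)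
  have hcα : ∀ n, (1 - b) * ρ * α n ≤ 1 := fun n => by
    have := hαρ n
    have := mul_pos hρ (hα n)
    nlinarith
  have hcβ : ∀ n, 1 - (1 - β n) * (ρ * α n) ≤ 1 - (1 - b) * ρ * α n := fun n => by
    have := mul_pos hρ (hα n)
    nlinarith [hβb n]
  have hdiff : Tendsto (fun n => ‖x (n + 1) - x n‖) atTop (nhds 0) := by
    refine tendsto_zero_of_le_one_sub_mul_add hc hα hcα hαsum
      ((hβreg.const_mul (2 * R + ‖g q‖ / ρ)).add (hαreg.const_mul (‖g q‖ + L * R)))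
      (fun _ => norm_nonneg _) fun n => ?_
    have h1 : x (n + 1 + 1) - x (n + 1) = β n • (x (n + 1) - x n)
        + ((β (n + 1) - β n) • (x (n + 1) - y (n + 1)) + (1 - β n) • (y (n + 1) - y n)) := by
      rw [hx (n + 1)]
      have h := hx n
      linear_combination (norm := module) -h
    have h2 : ‖y (n + 1) - y n‖ ≤ (1 - ρ * α n) * ‖x (n + 1) - x n‖
        + |α (n + 1) - α n| * (‖g q‖ + L * R) := by
      refine (norm_metricProjection_sub_le hP _ _).trans ?_
      have h3 : T (x (n + 1)) + α (n + 1) • g (x (n + 1)) - (T (x n) + α n • g (x n))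
          = (T (x (n + 1)) + α n • g (x (n + 1)) - (T (x n) + α n • g (x n)))
            + (α (n + 1) - α n) • g (x (n + 1)) := by module
      rw [h3]
      refine (norm_add_le _ _).trans ?_
      rw [norm_smul, Real.norm_eq_abs]
      exact add_le_add (hcontr n _ (hxQ _) _ (hxQ _))
        (mul_le_mul_of_nonneg_left (hgR _) (abs_nonneg _))
    have h3 : ‖x (n + 1) - y (n + 1)‖ ≤ 2 * R + ‖g q‖ / ρ := by
      have h := norm_sub_le (x (n + 1) - q) (y (n + 1) - q)
      rw [sub_sub_sub_cancel_right] at h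
      linarith [hR (n + 1), hyR (n + 1)]
    rw [h1]
    refine (norm_add_le _ _).trans ((add_le_add_right (norm_add_le _ _) _).trans ?_)
    rw [norm_smul, norm_smul, norm_smul, Real.norm_of_nonneg (hβ0 n),
      Real.norm_of_nonneg (hβ1 n).le, Real.norm_eq_abs]
    have h4 := mul_le_mul_of_nonneg_left h3 (abs_nonneg (β (n + 1) - β n))
    have h5 := mul_le_mul_of_nonneg_left h2 (hβ1 n).le
    have h6 := mul_le_mul_of_nonneg_right (hcβ n) (norm_nonneg (x (n + 1) - x n))
    have h7 : 0 ≤ β n * (|α (n + 1) - α n| * (‖g q‖ + L * R)) := by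
      have := hβ0 n
      positivity
    linarith
  have hxy : Tendsto (fun n => ‖x n - y n‖) atTop (nhds 0) := by
    refine squeeze_zero (fun _ => norm_nonneg _) (fun n => ?_)
      (by simpa using hdiff.div_const (1 - b))
    have h1 : x (n + 1) - x n = -((1 - β n) • (x n - y n)) := by
      rw [hx]; module
    rw [le_div_iff₀ (by linarith), h1, norm_neg, norm_smul, Real.norm_of_nonneg (hβ1 n).le]
    nlinarith [hβb n, norm_nonneg (x n - y n)]
  have hxT : Tendsto (fun n => ‖x n - T (x n)‖) atTop (nhds 0) := by
    refine squeeze_zero (fun _ => norm_nonneg _) (fun n => ?_)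
      (by simpa using hxy.add (hα0.mul_const (‖g q‖ + L * R)))
    have h1 := norm_metricProjection_sub_le hP (T (x n) + α n • g (x n)) (T (x n))
    rw [hPQ _ (hTmaps _ (hxQ n)), add_sub_cancel_left, norm_smul,
      Real.norm_of_nonneg (hα n).le] at h1
    have h2 := norm_sub_le_norm_sub_add_norm_sub (x n) (y n) (T (x n))
    linarith [mul_le_mul_of_nonneg_left (hgR n) (hα n).le]
  set δ : ℕ → ℝ := fun n => max ⟪g q, y n - q⟫ 0
  have hδ0 : Tendsto δ atTop (nhds 0) := by
    refine tendsto_order.2 ⟨fun ε hε => Eventually.of_forall fun n =>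
      hε.trans_le (le_max_right _ _), fun ε hε => ?_⟩
    have hxR : ∀ n, ‖x n‖ ≤ R + ‖q‖ := fun n => by
      linarith [hR n, norm_sub_norm_le (x n) q]
    have h1 := eventually_inner_lt_of_asymptotically_fixed hP hT hxQ hxR hxT hq (half_pos hε)
    have h2 : Tendsto (fun n => ‖g q‖ * ‖x n - y n‖) atTop (nhds 0) := by
      simpa using hxy.const_mul ‖g q‖
    filter_upwards [h1, h2.eventually (gt_mem_nhds (half_pos hε))] with n h3 h4
    have h5 := (neg_le_abs _).trans (abs_real_inner_le_norm (g q) (x n - y n))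
    have h6 : ⟪g q, y n - q⟫ = ⟪g q, x n - q⟫ - ⟪g q, x n - y n⟫ := by
      rw [← inner_sub_right, sub_sub_sub_cancel_left]
    exact max_lt (by linarith) hε
  have hneg : NegligibleRate α fun n => 2 * (α n * δ n) := by
    refine NegligibleRate.const_mul 2 (.of_summable_or (.inr ?_))
    simpa only [mul_div_cancel_left₀ _ (hα _).ne'] using hδ0
  have hsq : Tendsto (fun n => ‖x n - q‖ ^ 2) atTop (nhds 0) := by
    refine tendsto_zero_of_le_one_sub_mul_add hc hα hcα hαsum hneg (fun _ => sq_nonneg _)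
      fun n => ?_
    have hδn : 0 ≤ δ n := le_max_right _ _
    have h1 : ‖y n - q‖ ^ 2 ≤ (1 - ρ * α n) * ‖x n - q‖ ^ 2 + 2 * (α n * δ n) := by
      have h2 := (hP (T (x n) + α n • g (x n))).2 q hqQ
      have h3 : T (x n) + α n • g (x n) - y n
          = (T (x n) + α n • g (x n) - (T q + α n • g q)) + α n • g q - (y n - q) := by
        rw [hTq]; abel
      change ⟪T (x n) + α n • g (x n) - y n, q - y n⟫ ≤ 0 at h2
      rw [h3, ← neg_sub (y n) q, inner_neg_right, inner_sub_left, inner_add_left,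
        real_inner_smul_left, real_inner_self_eq_norm_sq] at h2
      have h4 := (real_inner_le_norm (T (x n) + α n • g (x n) - (T q + α n • g q))
        (y n - q)).trans (mul_le_mul_of_nonneg_right (hcontr n _ (hxQ n) q hqQ) (norm_nonneg _))
      have h5 : α n * ⟪g q, y n - q⟫ ≤ α n * δ n :=
        mul_le_mul_of_nonneg_left (le_max_left _ _) (hα n).le
      have h6 := mul_nonneg (sub_nonneg.2 (hαρ n)) (sq_nonneg (‖x n - q‖ - ‖y n - q‖))
      have h7 := mul_nonneg (mul_pos hρ (hα n)).le (sq_nonneg ‖y n - q‖)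
      linarith
    have h2 : ‖x (n + 1) - q‖ ^ 2 ≤ β n * ‖x n - q‖ ^ 2 + (1 - β n) * ‖y n - q‖ ^ 2 := by
      have h3 : x (n + 1) - q = β n • (x n - q) + (1 - β n) • (y n - q) := by
        rw [hx]; module
      have h4 := norm_add_le (β n • (x n - q)) ((1 - β n) • (y n - q))
      rw [← h3, norm_smul, norm_smul, Real.norm_of_nonneg (hβ0 n),
        Real.norm_of_nonneg (hβ1 n).le] at h4
      refine (pow_le_pow_left₀ (norm_nonneg _) h4 2).trans ?_
      have h5 := mul_nonneg (mul_nonneg (hβ0 n) (hβ1 n).le)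
        (sq_nonneg (‖x n - q‖ - ‖y n - q‖))
      linarith
    have h3 := mul_le_mul_of_nonneg_left h1 (hβ1 n).le
    have h4 := mul_le_mul_of_nonneg_right (hcβ n) (sq_nonneg ‖x n - q‖)
    have h5 := mul_nonneg (hβ0 n) (mul_nonneg (hα n).le hδn)
    linarith
  have hnorm : Tendsto (fun n => ‖x n - q‖) atTop (nhds 0) := by
    simpa using hsq.sqrt
  exact tendsto_iff_norm_sub_tendsto_zero.2 hnorm

/-- Errors that are negligible with respect to `α` do not affect the limit. -/
lemma tendsto_norm_sub_of_perturbed_iteration {Q : Set H} (hQ : Convex ℝ Q)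
    {P T g : H → H} (hP : ∀ x : H, P x ∈ Q ∧ ∀ y ∈ Q, ⟪x - P x, y - P x⟫ ≤ 0)
    {ρ b : ℝ} (hρ : 0 < ρ) (hb : b < 1) {α β : ℕ → ℝ} (hα : ∀ n, 0 < α n)
    (hαρ : ∀ n, ρ * α n ≤ 1)
    (hcontr : ∀ n, ∀ x ∈ Q, ∀ y ∈ Q,
      ‖(T x + α n • g x) - (T y + α n • g y)‖ ≤ (1 - ρ * α n) * ‖x - y‖)
    (hαsum : ¬ Summable α) (hβ0 : ∀ n, 0 ≤ β n) (hβb : ∀ n, β n ≤ b)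
    {e x z : ℕ → H} (he : NegligibleRate α fun n => ‖e n‖) (hx0 : x 0 ∈ Q) (hz0 : z 0 ∈ Q)
    (hx : ∀ n, x (n + 1) = β n • x n + (1 - β n) • P (T (x n) + α n • g (x n) + e n))
    (hz : ∀ n, z (n + 1) = β n • z n + (1 - β n) • P (T (z n) + α n • g (z n))) :
    Tendsto (fun n => ‖x n - z n‖) atTop (nhds 0) := by
  have hβ1 : ∀ n, 0 < 1 - β n := fun n => by linarith [hβb n]
  have hmem : ∀ n, x n ∈ Q ∧ z n ∈ Q := by
    intro n
    induction n with
    | zero => exact ⟨hx0, hz0⟩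
    | succ n ih =>
      rw [hx, hz]
      exact ⟨hQ ih.1 (hP _).1 (hβ0 n) (hβ1 n).le (by ring),
        hQ ih.2 (hP _).1 (hβ0 n) (hβ1 n).le (by ring)⟩
  have hb0 : 0 ≤ b := (hβ0 0).trans (hβb 0)
  refine tendsto_zero_of_le_one_sub_mul_add (c := (1 - b) * ρ) (mul_pos (by linarith) hρ) hα
    (fun n => ?_) hαsum he (fun _ => norm_nonneg _) fun n => ?_
  · have := hαρ n
    have := mul_pos hρ (hα n)
    nlinarith
  · have h1 : x (n + 1) - z (n + 1) = β n • (x n - z n) + (1 - β n) •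
        (P (T (x n) + α n • g (x n) + e n) - P (T (z n) + α n • g (z n))) := by
      rw [hx, hz]; module
    have h2 : ‖P (T (x n) + α n • g (x n) + e n) - P (T (z n) + α n • g (z n))‖
        ≤ (1 - ρ * α n) * ‖x n - z n‖ + ‖e n‖ := by
      refine (norm_metricProjection_sub_le hP _ _).trans ?_
      rw [add_sub_right_comm]
      exact (norm_add_le _ _).trans
        (add_le_add_left (hcontr n _ (hmem n).1 _ (hmem n).2) _)
    rw [h1]
    refine (norm_add_le _ _).trans ?_
    rw [norm_smul, norm_smul, Real.norm_of_nonneg (hβ0 n), Real.norm_of_nonneg (hβ1 n).le]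
    have h3 := mul_le_mul_of_nonneg_left h2 (hβ1 n).le
    have h4 := mul_nonneg (hβ0 n) (norm_nonneg (e n))
    have h5 := mul_nonneg (mul_nonneg (mul_pos hρ (hα n)).le (sub_nonneg.2 (hβb n)))
      (norm_nonneg (x n - z n))
    linarith

end Viscosity

/-- Theorem 2, case (h2): strong convergence of the perturbed algorithm (HPA) under the
conditions `limsup β_n < 1` plus regularity of `α_n` and `β_n`. -/
theorem hpa_convergence_h2
    {H : Type*} [NormedAddCommGroup H] [InnerProductSpace ℝ H] [CompleteSpace H]
    (Q : Set H) (hQne : Q.Nonempty) (hQclosed : IsClosed Q) (hQconvex : Convex ℝ Q)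
    (T f F : H → H)
    (hTmaps : ∀ x ∈ Q, T x ∈ Q)
    (hTnonexp : ∀ x ∈ Q, ∀ y ∈ Q, ‖T x - T y‖ ≤ ‖x - y‖)
    (C : Set H) (hC : C = {x | x ∈ Q ∧ T x = x}) (hCne : C.Nonempty)
    (αf : ℝ) (hαf : 0 ≤ αf)
    (hfLip : ∀ x ∈ Q, ∀ y ∈ Q, ‖f x - f y‖ ≤ αf * ‖x - y‖)
    (κ η : ℝ) (hκ : 0 < κ) (hη : 0 < η)
    (hFLip : ∀ x ∈ Q, ∀ y ∈ Q, ‖F x - F y‖ ≤ κ * ‖x - y‖)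
    (hFmono : ∀ x ∈ Q, ∀ y ∈ Q, η * ‖x - y‖ ^ 2 ≤ ⟪F x - F y, x - y⟫)
    (hαη : αf < η)
    (PQ : H → H)
    (hPQ : ∀ x : H, PQ x ∈ Q ∧ ∀ y ∈ Q, ⟪x - PQ x, y - PQ x⟫ ≤ 0)
    (e : ℕ → H) (α β : ℕ → ℝ)
    (hα : ∀ n, α n ∈ Set.Ioc (0 : ℝ) 1)
    (hβ : ∀ n, β n ∈ Set.Icc (0 : ℝ) 1)
    (hα0 : Tendsto α atTop (nhds 0))
    (hαsum : Tendsto (fun n => ∑ i ∈ Finset.range n, α i) atTop atTop)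
    (hβlimsup : limsup β atTop < 1)
    (hβreg : Tendsto (fun n => (β (n + 1) - β n) / α n) atTop (nhds 0)
      ∨ Summable fun n => |β (n + 1) - β n|)
    (hαreg : Tendsto (fun n => (α (n + 1) - α n) / α n) atTop (nhds 0)
      ∨ Summable fun n => |α (n + 1) - α n|)
    (he : (Summable fun n => ‖e n‖) ∨ Tendsto (fun n => ‖e n‖ / α n) atTop (nhds 0))
    (x : ℕ → H) (hx0 : x 0 ∈ Q)
    (hrec : ∀ n, x (n + 1) = β n • x n
      + (1 - β n) • PQ (α n • f (x n) + (T (x n) - α n • F (T (x n))) + e n))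
    (qstar : H) (hqstarC : qstar ∈ C)
    (hqstarVIP : ∀ p ∈ C, 0 ≤ ⟪F qstar - f qstar, p - qstar⟫) :
    Tendsto x atTop (nhds qstar) := by
  subst hC
  obtain ⟨hqQ, hTq⟩ := hqstarC
  obtain ⟨b, hβb', hb⟩ := exists_between hβlimsup
  have hβev : ∀ᶠ n in atTop, β n < b := eventually_lt_of_limsup_lt hβb'
    (isBoundedUnder_of ⟨1, fun n => (hβ n).2⟩)
  set ρ : ℝ := (η - αf) / 2 with hρdef
  have hρ : 0 < ρ := by rw [hρdef]; linarith
  have hsmall : ∀ᶠ n in atTop, α n * κ ^ 2 ≤ η - αf ∧ α n * (η + αf) ≤ 2 := by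
    have h1 : Tendsto (fun n => α n * κ ^ 2) atTop (nhds 0) := by
      simpa using hα0.mul_const (κ ^ 2)
    have h2 : Tendsto (fun n => α n * (η + αf)) atTop (nhds 0) := by
      simpa using hα0.mul_const (η + αf)
    exact (h1.eventually_le_const (by linarith)).and (h2.eventually_le_const (by norm_num))
  obtain ⟨N, hN⟩ := eventually_atTop.1 (hβev.and hsmall)
  have hxQ : ∀ n, x n ∈ Q := by
    intro n
    induction n with
    | zero => exact hx0
    | succ n ih =>
      rw [hrec]
      exact hQconvex ih (hPQ _).1 (hβ n).1 (sub_nonneg.2 (hβ n).2) (by ring)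
  let g : H → H := fun u => f u - F (T u)
  let z : ℕ → H := fun n => Nat.rec (x N) (fun k u => β (k + N) • u
    + (1 - β (k + N)) • PQ (T u + α (k + N) • g u)) n
  have hαpos : ∀ n, 0 < α (n + N) := fun n => (hα _).1
  have hαρ : ∀ n, ρ * α (n + N) ≤ 1 := fun n => by
    have h1 := (hN (n + N) (by omega)).2.2
    have h2 := mul_nonneg hαf (hαpos n).le
    rw [hρdef]
    linarith
  have hcontr : ∀ n, ∀ u ∈ Q, ∀ v ∈ Q, ‖(T u + α (n + N) • g u) - (T v + α (n + N) • g v)‖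
      ≤ (1 - ρ * α (n + N)) * ‖u - v‖ := fun n u hu v hv =>
    norm_regularized_step_sub_le hTmaps hTnonexp hfLip hFLip hFmono (hαpos n).le
      (hN (n + N) (by omega)).2.1 (hN (n + N) (by omega)).2.2 hu hv
  have hnsum : ¬ Summable fun n => α (n + N) := fun h =>
    (not_summable_iff_tendsto_nat_atTop_of_nonneg fun n => (hα n).1.le).2 hαsum
      ((summable_nat_add_iff N).1 h)
  have hβ0 : ∀ n, 0 ≤ β (n + N) := fun n => (hβ _).1
  have hβb : ∀ n, β (n + N) ≤ b := fun n => (hN (n + N) (by omega)).1.le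
  have hreg : ∀ c : ℕ → ℝ, (Tendsto (fun n => (c (n + 1) - c n) / α n) atTop (nhds 0)
      ∨ Summable fun n => |c (n + 1) - c n|) →
      NegligibleRate (fun n => α (n + N)) fun n => |c (n + 1 + N) - c (n + N)| := by
    intro c hc
    have h : NegligibleRate α fun n => |c (n + 1) - c n| := by
      refine .of_summable_or (hc.symm.imp_right fun h => ?_)
      simpa only [abs_div, abs_of_pos (hα _).1, abs_zero] using h.abs
    simpa only [add_right_comm] using h.comp_add N
  have hgLip : ∀ u ∈ Q, ∀ v ∈ Q, ‖g u - g v‖ ≤ (αf + κ) * ‖u - v‖ := by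
    intro u hu v hv
    have h1 := norm_sub_le (f u - f v) (F (T u) - F (T v))
    have h2 := hFLip _ (hTmaps u hu) _ (hTmaps v hv)
    have h3 := mul_le_mul_of_nonneg_left (hTnonexp u hu v hv) hκ.le
    rw [sub_sub_sub_comm] at h1
    linarith [hfLip u hu v hv]
  have hq : ∀ p ∈ Q, T p = p → ⟪g qstar, p - qstar⟫ ≤ 0 := by
    intro p hp hTp
    have h := hqstarVIP p ⟨hp, hTp⟩
    rw [← neg_sub (f qstar), inner_neg_left] at h
    simp only [g, hTq]
    linarith
  have hzlim : Tendsto z atTop (nhds qstar) :=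
    tendsto_relaxed_projected_iteration hQconvex hPQ hTmaps hTnonexp (by positivity) hgLip hρ hb
      hαpos hαρ hcontr ((tendsto_add_atTop_iff_nat N).2 hα0) hnsum hβ0 hβb (hreg α hαreg)
      (hreg β hβreg) hqQ hTq hq (hxQ N) fun _ => rfl
  have hxz : Tendsto (fun n => ‖x (n + N) - z n‖) atTop (nhds 0) := by
    refine tendsto_norm_sub_of_perturbed_iteration hQconvex hPQ hρ hb hαpos hαρ hcontr hnsum hβ0
      hβb (e := fun n => e (n + N)) (x := fun n => x (n + N))
      ((NegligibleRate.of_summable_or he).comp_add N) (hxQ _) (hxQ N) (fun n => ?_) fun _ => rfl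
    have h : α (n + N) • f (x (n + N)) + (T (x (n + N)) - α (n + N) • F (T (x (n + N))))
        = T (x (n + N)) + α (n + N) • g (x (n + N)) := by
      simp only [g]; module
    rw [add_right_comm n 1 N, hrec, h]
  have hsum := (tendsto_zero_iff_norm_tendsto_zero.2 hxz).add hzlim
  simp only [sub_add_cancel, zero_add] at hsum
  exact (tendsto_add_atTop_iff_nat N).1 hsum
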